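/- Let m ≥ 1 and n ≥ 2m + 2 be integers and define F : (−1, 1) → ℝ by F(r) = ⨍_{−1}^{1} T_n(s)·(1−s²)^{m−1/2}/(s−r) ds (Cauchy principal value). Then F is twice differentiable on (−1, 1) and F″(r) = 2 · (−1)^{m+1}·(1/2)^{2m+1}·(π/(1−r²)) · Σ_{j=0}^{2m−1} (−1)^j · C(2m−1, j) · (n+1−2m+2j) · [ (n+2−2m+2j)·U_{n−1−2m+2j}(r) − (n−2m+2j)·U_{n+1−2m+2j}(r) ], where C(2m−1, j) denotes the binomial coefficient. (The cubic Hadamard finite-part integral ⨎_{−1}^{1} T_n(s)·(1−s²)^{m−1/2}/(s−r)³ ds equals F″(r)/2.) -/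

import Mathlib

open Polynomial.Chebyshev Filter Topology

noncomputable def PVf (g : ℝ → ℝ) (r ε : ℝ) : ℝ :=
  (∫ s in (-1 : ℝ)..(r - ε), g s / (s - r)) + ∫ s in (r + ε)..(1 : ℝ), g s / (s - r)

noncomputable def HPV (g : ℝ → ℝ) (r L : ℝ) : Prop := Tendsto (PVf g r) (𝓝[>] 0) (𝓝 L)

lemma pv_int {g : ℝ → ℝ} (hg : Continuous g) {r a b : ℝ} (h : r ∉ Set.uIcc a b) :
    IntervalIntegrable (fun s => g s / (s - r)) MeasureTheory.volume a b := by
  apply ContinuousOn.intervalIntegrable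
  apply hg.continuousOn.div (by fun_prop)
  intro x hx hx'
  apply h
  have : x = r := by linarith
  rwa [← this]

lemma pv_l {r ε : ℝ} (hr : r ∈ Set.Ioo (-1 : ℝ) 1) (hε : 0 < ε) : r ∉ Set.uIcc (-1) (r - ε) := by
  intro h
  rw [Set.mem_uIcc] at h
  rcases h with h | h <;> linarith [hr.1, hr.2, h.1, h.2]

lemma pv_r {r ε : ℝ} (hr : r ∈ Set.Ioo (-1 : ℝ) 1) (hε : 0 < ε) : r ∉ Set.uIcc (r + ε) 1 := by
  intro h
  rw [Set.mem_uIcc] at h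
  rcases h with h | h <;> linarith [hr.1, hr.2, h.1, h.2]

lemma HPV.add {g h : ℝ → ℝ} {r L M : ℝ} (hr : r ∈ Set.Ioo (-1 : ℝ) 1) (hg : Continuous g)
    (hh : Continuous h) (H1 : HPV g r L) (H2 : HPV h r M) :
    HPV (fun s => g s + h s) r (L + M) := by
  refine (Tendsto.add H1 H2).congr' ?_
  filter_upwards [self_mem_nhdsWithin] with ε hε
  unfold PVf
  simp only [add_div]
  rw [intervalIntegral.integral_add (pv_int hg (pv_l hr hε)) (pv_int hh (pv_l hr hε)),
    intervalIntegral.integral_add (pv_int hg (pv_r hr hε)) (pv_int hh (pv_r hr hε))]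
  ring

lemma HPV.const_mul {g : ℝ → ℝ} {r L : ℝ} (c : ℝ) (H1 : HPV g r L) :
    HPV (fun s => c * g s) r (c * L) := by
  refine (Tendsto.const_mul c H1).congr ?_
  intro ε
  unfold PVf
  simp only [mul_div_assoc]
  rw [intervalIntegral.integral_const_mul, intervalIntegral.integral_const_mul]
  ring

lemma HPV.zero (r : ℝ) : HPV (fun _ => 0) r 0 := by
  unfold HPV
  have : PVf (fun _ => 0) r = fun _ => 0 := by
    funext ε; simp [PVf]
  rw [this]; exact tendsto_const_nhds

lemma HPV.sum {r : ℝ} (hr : r ∈ Set.Ioo (-1 : ℝ) 1) {g : ℕ → ℝ → ℝ} {L : ℕ → ℝ} (N : ℕ)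
    (hg : ∀ j, Continuous (g j)) (H : ∀ j, j < N → HPV (g j) r (L j)) :
    HPV (fun s => ∑ j ∈ Finset.range N, g j s) r (∑ j ∈ Finset.range N, L j) := by
  induction N with
  | zero => simpa using HPV.zero r
  | succ N ih =>
    simp only [Finset.sum_range_succ]
    exact HPV.add hr (continuous_finsetSum _ fun j _ => hg j) (hg N)
      (ih fun j hj => H j (by omega)) (H N (by omega))

lemma HPV.id_mul {g : ℝ → ℝ} {r L : ℝ} (hr : r ∈ Set.Ioo (-1 : ℝ) 1) (hg : Continuous g)
    (H1 : HPV g r L) :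
    HPV (fun s => s * g s) r (r * L + ∫ s in (-1 : ℝ)..1, g s) := by
  have hI : Tendsto (fun ε : ℝ => (∫ s in (-1 : ℝ)..(r - ε), g s) + ∫ s in (r + ε)..(1 : ℝ), g s)
      (𝓝[>] 0) (𝓝 (∫ s in (-1 : ℝ)..1, g s)) := by
    have hc : Continuous (fun ε : ℝ => (∫ s in (-1 : ℝ)..(r - ε), g s) -
        ∫ s in (1 : ℝ)..(r + ε), g s) := by
      have h0 : ∀ a : ℝ, Continuous (fun x => ∫ s in a..x, g s) := fun a =>
        intervalIntegral.continuous_primitive (fun a b => hg.intervalIntegrable a b) a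
      exact ((h0 _).comp (by fun_prop : Continuous fun ε : ℝ => r - ε)).sub
        ((h0 _).comp (by fun_prop : Continuous fun ε : ℝ => r + ε))
    have h2 := (hc.tendsto 0).mono_left (nhdsWithin_le_nhds (s := Set.Ioi 0))
    have e : (∫ s in (-1 : ℝ)..(r - 0), g s) - ∫ s in (1 : ℝ)..(r + 0), g s
        = ∫ s in (-1 : ℝ)..1, g s := by
      rw [sub_zero, add_zero, intervalIntegral.integral_symm r 1, sub_neg_eq_add]
      exact intervalIntegral.integral_add_adjacent_intervals (hg.intervalIntegrable _ _)
        (hg.intervalIntegrable _ _)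
    rw [e] at h2
    refine h2.congr fun ε => ?_
    rw [intervalIntegral.integral_symm (r + ε) 1, sub_neg_eq_add]
  refine ((Tendsto.const_mul r H1).add hI).congr' ?_
  filter_upwards [self_mem_nhdsWithin] with ε hε
  have key : ∀ a b : ℝ, r ∉ Set.uIcc a b → ∫ s in a..b, s * g s / (s - r) =
      r * (∫ s in a..b, g s / (s - r)) + ∫ s in a..b, g s := by
    intro a b h
    rw [← intervalIntegral.integral_const_mul, ← intervalIntegral.integral_add
      ((pv_int hg h).const_mul r) (hg.intervalIntegrable _ _)]
    apply intervalIntegral.integral_congr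
    intro s hs
    have : s - r ≠ 0 := fun h' => h (by rwa [← sub_eq_zero.mp h'])
    field_simp
    ring
  unfold PVf
  rw [key _ _ (pv_l hr hε), key _ _ (pv_r hr hε)]
  ring

lemma int_U (k : ℤ) (hk : 1 ≤ k) :
    ∫ s in (-1 : ℝ)..1, (U ℝ k).eval s * √(1 - s ^ 2) = 0 := by
  have h1 := integral_eval_T_real_measureT_of_ne_zero (n := k) (by omega)
  have h2 := integral_eval_T_real_measureT_of_ne_zero (n := k + 2) (by omega)
  have hi1 : MeasureTheory.Integrable (fun x => (T ℝ k).eval x) measureT :=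
    integrable_measureT (by fun_prop)
  have hi2 : MeasureTheory.Integrable (fun x => (T ℝ (k + 2)).eval x) measureT :=
    integrable_measureT (by fun_prop)
  have h3 := MeasureTheory.integral_sub hi1 hi2
  rw [h1, h2, integral_measureT] at h3
  have : ∫ s in (-1 : ℝ)..1, (U ℝ k).eval s * √(1 - s ^ 2) =
     ∫ s in (-1 : ℝ)..1, (1/2) * (((T ℝ k).eval s - (T ℝ (k + 2)).eval s) * √(1 - s ^ 2)⁻¹) := by
    apply intervalIntegral.integral_congr
    intro s hs
    rw [Set.uIcc_of_le (by norm_num)] at hs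
    have hw : 0 ≤ 1 - s ^ 2 := by nlinarith [hs.1, hs.2]
    have e1 := congrArg (Polynomial.eval s) (one_sub_X_sq_mul_U_eq_pol_in_T ℝ k)
    have e2 := congrArg (Polynomial.eval s) (T_add_two ℝ k)
    rw [Polynomial.eval_sub, Polynomial.eval_mul, Polynomial.eval_mul, Polynomial.eval_X, Polynomial.eval_ofNat] at e2
    rw [Polynomial.eval_sub, Polynomial.eval_mul, Polynomial.eval_mul, Polynomial.eval_X] at e1
    simp only [Polynomial.eval_sub, Polynomial.eval_one, Polynomial.eval_pow, Polynomial.eval_X] at e1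
    have e3 : (T ℝ k).eval s - (T ℝ (k + 2)).eval s = 2 * ((1 - s ^ 2) * (U ℝ k).eval s) := by
      linarith
    have e4 : (1 - s ^ 2) * √(1 - s ^ 2)⁻¹ = √(1 - s ^ 2) := by
      rw [Real.sqrt_inv]
      exact Real.div_sqrt
    show (U ℝ k).eval s * √(1 - s ^ 2) = 1 / 2 * (((T ℝ k).eval s - (T ℝ (k + 2)).eval s) * _)
    rw [e3]; nth_rw 1 [← e4]; ring
  rw [this, intervalIntegral.integral_const_mul, h3]; simp

lemma trig_id (m n : ℕ) (θ : ℝ) :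
    Real.cos (n * θ) * Real.sin θ ^ (2 * m + 1) =
      (-1 : ℝ) ^ (m + 1) * (1 / 2) ^ (2 * m + 1) * ∑ j ∈ Finset.range (2 * m + 2),
        (-1 : ℝ) ^ j * (Nat.choose (2 * m + 1) j : ℝ) * Real.sin (((n : ℝ) - 1 - 2 * m + 2 * j) * θ) := by
  have h : ∑ j ∈ Finset.range (2 * m + 2),
      (-1 : ℂ) ^ j * (Nat.choose (2 * m + 1) j : ℂ) *
        Complex.exp ((((n : ℝ) - 1 - 2 * m + 2 * j) * θ : ℝ) * Complex.I) =
      Complex.exp (((n * θ : ℝ) : ℂ) * Complex.I) * (-2 * Complex.I * Real.sin θ) ^ (2 * m + 1) := by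
    have e : -2 * Complex.I * Real.sin θ = Complex.exp (-θ * Complex.I) - Complex.exp (θ * Complex.I) := by
      rw [Complex.ofReal_sin, Complex.sin]
      linear_combination (Complex.exp (θ * Complex.I) - Complex.exp (-θ * Complex.I)) * Complex.I_sq
    rw [e, sub_eq_add_neg (Complex.exp _), add_comm (Complex.exp _), add_pow, Finset.mul_sum]
    apply Finset.sum_congr rfl
    intro j hj
    have hj' : j ≤ 2 * m + 1 := by simp at hj; omega
    rw [neg_pow (Complex.exp _), ← Complex.exp_nat_mul, ← Complex.exp_nat_mul]
    rw [show ((((n : ℝ) - 1 - 2 * m + 2 * j) * θ : ℝ) * Complex.I : ℂ) =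
      ((n * θ : ℝ) : ℂ) * Complex.I + j * (θ * Complex.I) +
        ((2 * m + 1 - j : ℕ) : ℂ) * (-θ * Complex.I) by
        push_cast [Nat.cast_sub hj']; ring, Complex.exp_add, Complex.exp_add]
    ring
  have h2 := congrArg Complex.im h
  rw [Complex.im_sum] at h2
  have l : ∀ j : ℕ, ((-1 : ℂ) ^ j * (Nat.choose (2 * m + 1) j : ℂ) *
        Complex.exp ((((n : ℝ) - 1 - 2 * m + 2 * j) * θ : ℝ) * Complex.I)).im =
        (-1 : ℝ) ^ j * (Nat.choose (2 * m + 1) j : ℝ) * Real.sin (((n : ℝ) - 1 - 2 * m + 2 * j) * θ) := by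
    intro j
    rw [show ((-1 : ℂ) ^ j * (Nat.choose (2 * m + 1) j : ℂ)) =
      (((-1 : ℝ) ^ j * (Nat.choose (2 * m + 1) j : ℝ) : ℝ) : ℂ) by push_cast; rfl,
      Complex.im_ofReal_mul, Complex.exp_ofReal_mul_I_im]
  simp only [l] at h2
  rw [h2]
  have e : (-2 * Complex.I * Real.sin θ) ^ (2 * m + 1) =
      (((-1) ^ (m + 1) * 2 ^ (2 * m + 1) * Real.sin θ ^ (2 * m + 1) : ℝ) : ℂ) * Complex.I := by
    rw [mul_pow, mul_pow, pow_succ Complex.I, pow_mul Complex.I, Complex.I_sq, neg_pow,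
      pow_succ (-1 : ℂ) (2 * m), pow_mul (-1 : ℂ)]
    push_cast
    ring
  rw [e, mul_left_comm, Complex.im_ofReal_mul, Complex.mul_I_im, Complex.exp_ofReal_mul_I_re]
  have e5 : ((-1 : ℝ) ^ (m + 1)) * (-1) ^ (m + 1) = 1 := by
    rw [← mul_pow]; simp
  have e6 : ((1 / 2 : ℝ) ^ (2 * m + 1)) * 2 ^ (2 * m + 1) = 1 := by
    rw [← mul_pow]; simp
  linear_combination (-Real.cos (n * θ) * Real.sin θ ^ (2 * m + 1)) *
    (e5 + (-1 : ℝ) ^ (m + 1) * (-1) ^ (m + 1) * (e6))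

lemma integrand_id (m n : ℕ) {s : ℝ} (hs : s ∈ Set.Icc (-1 : ℝ) 1) :
    (T ℝ n).eval s * (1 - s ^ 2) ^ (((m + 1 : ℕ) : ℝ) - 1 / 2) =
      ∑ j ∈ Finset.range (2 * m + 2), ((-1 : ℝ) ^ (m + 1) * (1 / 2) ^ (2 * m + 1) * 
        ((-1 : ℝ) ^ j * (Nat.choose (2 * m + 1) j : ℝ))) *
          ((U ℝ ((n : ℤ) - 2 - 2 * m + 2 * j)).eval s * √(1 - s ^ 2)) := by
  obtain ⟨θ, h0, h1, rfl⟩ : ∃ θ, 0 ≤ θ ∧ θ ≤ Real.pi ∧ Real.cos θ = s :=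
    ⟨Real.arccos s, Real.arccos_nonneg s, Real.arccos_le_pi s, Real.cos_arccos hs.1 hs.2⟩
  have hsin := Real.sin_nonneg_of_nonneg_of_le_pi h0 h1
  have e1 : 1 - Real.cos θ ^ 2 = Real.sin θ ^ 2 := by linarith [Real.sin_sq_add_cos_sq θ]
  have e2 : (Real.sin θ ^ 2) ^ (((m + 1 : ℕ) : ℝ) - 1 / 2) = Real.sin θ ^ (2 * m + 1) := by
    rw [← Real.rpow_natCast, ← Real.rpow_mul hsin, ← Real.rpow_natCast]
    congr 1; push_cast; ring
  rw [e1, e2, Real.sqrt_sq hsin]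
  simp only [U_real_cos, T_real_cos]
  rw [Int.cast_natCast, trig_id, Finset.mul_sum]
  apply Finset.sum_congr rfl
  intro j _
  push_cast
  rw [show ((n : ℝ) - 2 - 2 * m + 2 * j + 1) = (n : ℝ) - 1 - 2 * m + 2 * j by ring]
  ring

lemma T_second (k : ℤ) {r : ℝ} (hr : 1 - r ^ 2 ≠ 0) :
    (Polynomial.derivative (Polynomial.derivative (T ℝ k))).eval r =
      (1 / 2) * (1 / (1 - r ^ 2)) * (k * ((k + 1) * (U ℝ (k - 2)).eval r - (k - 1) * (U ℝ k).eval r)) := by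
  have e := congrArg (Polynomial.eval r) (one_sub_X_sq_mul_derivative_derivative_T_eq_poly_in_T (R := ℝ) k)
  simp [T_derivative_eq_U] at e
  have e1 := congrArg (Polynomial.eval r) (T_eq_U_sub_X_mul_U ℝ k)
  have e2 := congrArg (Polynomial.eval r) (U_eq ℝ k)
  simp at e1 e2
  field_simp
  simp [T_derivative_eq_U]
  rw [e1] at e
  linear_combination 2 * e - k * (k + 1) * e2

lemma HPV.base {r : ℝ} (hr : r ∈ Set.Ioo (-1 : ℝ) 1) :
    HPV (fun s => √(1 - s ^ 2)) r (-Real.pi * r) := by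
  obtain ⟨hr1, hr2⟩ := hr
  set c := √(1 - r ^ 2) with hc
  have hc2 : c ^ 2 = 1 - r ^ 2 := Real.sq_sqrt (by nlinarith)
  have hc0 : 0 ≤ c := Real.sqrt_nonneg _
  let D : ℝ → ℝ := fun s => 1 - r * s + c * √(1 - s ^ 2)
  have hD : ∀ s ∈ Set.Icc (-1 : ℝ) 1, 0 < D s := by
    intro s hs
    have h1 : 0 < 1 - r * s := by
      rcases le_total 0 r with h | h
      · nlinarith [mul_nonneg h (sub_nonneg.mpr hs.2)]
      · nlinarith [mul_nonneg (neg_nonneg.mpr h) (sub_nonneg.mpr hs.1)]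
    have h2 : 0 ≤ c * √(1 - s ^ 2) := mul_nonneg hc0 (Real.sqrt_nonneg _)
    show 0 < 1 - r * s + c * √(1 - s ^ 2)
    linarith
  have hDc : Continuous D := by fun_prop
  let A : ℝ → ℝ := fun s => √(1 - s ^ 2) - r * Real.arcsin s - c * Real.log (D s)
  have hA : ContinuousOn A (Set.Icc (-1) 1) := by
    apply ContinuousOn.sub
    · fun_prop
    · exact continuousOn_const.mul (hDc.continuousOn.log fun s hs => (hD s hs).ne')
  let Φ : ℝ → ℝ := fun s => A s + c * Real.log (s - r)
  have hder : ∀ s ∈ Set.Ioo (-1 : ℝ) 1, s ≠ r → HasDerivAt Φ (√(1 - s ^ 2) / (s - r)) s := by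
    intro s hs hsr
    have hw2 : 0 < 1 - s ^ 2 := by nlinarith [hs.1, hs.2]
    have hw : 0 < √(1 - s ^ 2) := Real.sqrt_pos.mpr hw2
    have hwsq : √(1 - s ^ 2) ^ 2 = 1 - s ^ 2 := Real.sq_sqrt hw2.le
    have d0 : HasDerivAt (fun s : ℝ => √(1 - s ^ 2)) (-s / √(1 - s ^ 2)) s := by
      have := ((hasDerivAt_pow 2 s).const_sub 1).sqrt hw2.ne'
      refine this.congr_deriv ?_
      push_cast
      field_simp
    have d1 : HasDerivAt D (-r + c * (-s / √(1 - s ^ 2))) s := by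
      have := (((hasDerivAt_id s).const_mul r).const_sub 1).add (d0.const_mul c)
      refine this.congr_deriv ?_
      ring
    have hDs := hD s ⟨hs.1.le, hs.2.le⟩
    have d2 := d1.log hDs.ne'
    have hsr' : s - r ≠ 0 := sub_ne_zero.mpr hsr
    have d3 := ((hasDerivAt_id s).sub_const r).log hsr'
    have d4 := ((d0.sub ((Real.hasDerivAt_arcsin hs.1.ne' hs.2.ne).const_mul r)).sub
      (d2.const_mul c)).add (d3.const_mul c)
    refine d4.congr_deriv ?_
    have hDe : D s = 1 - r * s + c * √(1 - s ^ 2) := rfl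
    have key : c * (1 / (s - r)) - c * ((-r + c * (-s / √(1 - s ^ 2))) / D s) =
        (1 - r ^ 2) / (√(1 - s ^ 2) * (s - r)) := by
      rw [← hc2]
      set w := √(1 - s ^ 2)
      have hDs' := hDs.ne'
      field_simp
      rw [hDe]
      linear_combination c ^ 2 * hwsq - c * w * hc2
    have e : √(1 - s ^ 2) / (s - r) = -s / √(1 - s ^ 2) - r * (1 / √(1 - s ^ 2)) +
        (1 - r ^ 2) / (√(1 - s ^ 2) * (s - r)) := by
      field_simp
      linear_combination hwsq
    simp only [id]
    rw [e, ← key]; ring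
  have hcont : ∀ a b : ℝ, -1 ≤ a → b ≤ 1 → r ∉ Set.Icc a b → ContinuousOn Φ (Set.Icc a b) := by
    intro a b ha hb h
    apply (hA.mono (Set.Icc_subset_Icc ha hb)).add
    apply continuousOn_const.mul
    apply ContinuousOn.log (by fun_prop)
    intro x hx h'
    exact h (by rwa [← sub_eq_zero.mp h'])
  have hint : ∀ a b : ℝ, a ≤ b → -1 ≤ a → b ≤ 1 → r ∉ Set.Icc a b →
      ∫ s in a..b, √(1 - s ^ 2) / (s - r) = Φ b - Φ a := by
    intro a b hab ha hb h
    apply intervalIntegral.integral_eq_sub_of_hasDerivAt_of_le hab (hcont a b ha hb h)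
    · intro x hx
      exact hder x ⟨by linarith [hx.1], by linarith [hx.2]⟩
        (fun h' => h (by rw [← h']; exact ⟨hx.1.le, hx.2.le⟩))
    · exact pv_int (g := fun s => √(1 - s ^ 2)) (by fun_prop) (by rwa [Set.uIcc_of_le hab])
  have hΦ1 : Φ 1 = -Real.pi * r / 2 := by
    simp [Φ, A, D]; ring
  have hΦ2 : Φ (-1) = Real.pi * r / 2 := by
    have : (-1 - r) = -(1 + r) := by ring
    simp [Φ, A, D, this, -neg_add_rev, Real.log_neg_eq_log]; ring
  have hAr : ContinuousAt A r := hA.continuousAt (Icc_mem_nhds hr1 hr2)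
  have t1 : Tendsto (fun ε : ℝ => A (r - ε)) (𝓝[>] 0) (𝓝 (A r)) := by
    refine (hAr.tendsto.comp ?_)
    have : Tendsto (fun ε : ℝ => r - ε) (𝓝 0) (𝓝 (r - 0)) := Continuous.tendsto (by fun_prop) 0
    rw [sub_zero] at this
    exact this.mono_left nhdsWithin_le_nhds
  have t2 : Tendsto (fun ε : ℝ => A (r + ε)) (𝓝[>] 0) (𝓝 (A r)) := by
    refine (hAr.tendsto.comp ?_)
    have : Tendsto (fun ε : ℝ => r + ε) (𝓝 0) (𝓝 (r + 0)) := Continuous.tendsto (by fun_prop) 0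
    rw [add_zero] at this
    exact this.mono_left nhdsWithin_le_nhds
  have t3 := (t1.sub t2).add_const (-Real.pi * r)
  rw [sub_self, zero_add] at t3
  refine t3.congr' ?_
  have hs : Set.Ioo (0 : ℝ) (min (r + 1) (1 - r)) ∈ 𝓝[>] (0 : ℝ) :=
    Ioo_mem_nhdsGT (lt_min (by linarith) (by linarith))
  filter_upwards [hs] with ε hε
  have h1 := lt_min_iff.mp hε.2
  have h0 := hε.1
  unfold PVf
  rw [hint (-1) (r - ε) (by linarith) le_rfl (by linarith) (fun h => by linarith [h.2]),
    hint (r + ε) 1 (by linarith) (by linarith) le_rfl (fun h => by linarith [h.1]), hΦ1, hΦ2]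
  simp only [Φ]
  rw [show r - ε - r = -ε by ring, show r + ε - r = ε by ring, Real.log_neg_eq_log]
  ring

lemma HPV.U {r : ℝ} (hr : r ∈ Set.Ioo (-1 : ℝ) 1) (k : ℕ) :
    HPV (fun s => (U ℝ k).eval s * √(1 - s ^ 2)) r (-Real.pi * (T ℝ (k + 1)).eval r) := by
  induction k using Nat.twoStepInduction with
  | zero => simpa using HPV.base hr
  | one =>
    have h := ((HPV.base hr).id_mul hr (by fun_prop)).const_mul 2
    rw [integral_sqrt_one_sub_sq] at h
    convert h using 1
    · funext s; simp; ring
    · have : (T ℝ 2) = 2 * Polynomial.X ^ 2 - 1 := T_two ℝ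
      norm_num [this]; ring
  | more k h1 h2 =>
    have h := (((h2.id_mul hr (by fun_prop)).const_mul 2).add hr (by fun_prop) (by fun_prop)
      (h1.const_mul (-1)))
    rw [int_U _ (by omega)] at h
    have e1 := U_add_two ℝ (k : ℤ)
    have e2 := T_add_two ℝ ((k : ℤ) + 1)
    convert h using 1
    · funext s
      push_cast
      rw [e1]; simp; ring
    · push_cast
      rw [show (k : ℤ) + 2 + 1 = k + 1 + 2 by ring, e2]; simp; ring

theorem hfp3_T_general (m n : ℕ) (hm : 1 ≤ m) (hn : 2 * m + 2 ≤ n) (F : ℝ → ℝ)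
    (hF : ∀ r ∈ Set.Ioo (-1 : ℝ) 1,
      Filter.Tendsto
        (fun ε : ℝ =>
          (∫ s in (-1 : ℝ)..(r - ε),
              (Polynomial.Chebyshev.T ℝ n).eval s * (1 - s ^ 2) ^ ((m : ℝ) - 1 / 2) / (s - r)) +
          ∫ s in (r + ε)..(1 : ℝ),
              (Polynomial.Chebyshev.T ℝ n).eval s * (1 - s ^ 2) ^ ((m : ℝ) - 1 / 2) / (s - r))
        (nhdsWithin 0 (Set.Ioi 0)) (nhds (F r))) :
    ∃ F' : ℝ → ℝ,
      (∀ r ∈ Set.Ioo (-1 : ℝ) 1, HasDerivAt F (F' r) r) ∧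
      (∀ r ∈ Set.Ioo (-1 : ℝ) 1,
        HasDerivAt F'
          (2 * ((-1 : ℝ) ^ (m + 1) * (1 / 2 : ℝ) ^ (2 * m + 1) * (Real.pi / (1 - r ^ 2)) *
            ∑ j ∈ Finset.range (2 * m), (-1 : ℝ) ^ j * (Nat.choose (2 * m - 1) j : ℝ) *
              ((n : ℝ) + 1 - 2 * m + 2 * j) *
              (((n : ℝ) + 2 - 2 * m + 2 * j) *
                  (Polynomial.Chebyshev.U ℝ ((n : ℤ) - 1 - 2 * m + 2 * j)).eval r -
               ((n : ℝ) - 2 * m + 2 * j) *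
                  (Polynomial.Chebyshev.U ℝ ((n : ℤ) + 1 - 2 * m + 2 * j)).eval r))) r) := by
  obtain ⟨m, rfl⟩ : ∃ k, m = k + 1 := ⟨m - 1, by omega⟩
  set a : ℕ → ℝ := fun j => (-1 : ℝ) ^ (m + 1) * (1 / 2) ^ (2 * m + 1) *
        ((-1 : ℝ) ^ j * (Nat.choose (2 * m + 1) j : ℝ)) with ha
  let K : ℕ → ℤ := fun j => (n : ℤ) - 1 - 2 * m + 2 * j
  let P : Polynomial ℝ := ∑ j ∈ Finset.range (2 * m + 2),
    Polynomial.C (-Real.pi * a j) * T ℝ (K j)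
  have hFP : ∀ r ∈ Set.Ioo (-1 : ℝ) 1, F r = P.eval r := by
    intro r hr
    have h1 : HPV (fun s => ∑ j ∈ Finset.range (2 * m + 2), a j *
        ((U ℝ ((n : ℤ) - 2 - 2 * m + 2 * j)).eval s * √(1 - s ^ 2))) r
        (∑ j ∈ Finset.range (2 * m + 2), a j * (-Real.pi * (T ℝ (K j)).eval r)) := by
      apply HPV.sum hr
      · intro j; fun_prop
      · intro j _
        apply HPV.const_mul
        have h := HPV.U hr (n - 2 - 2 * m + 2 * j)
        have e : ((n - 2 - 2 * m + 2 * j : ℕ) : ℤ) = (n : ℤ) - 2 - 2 * m + 2 * j := by omega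
        rw [e] at h
        rwa [show (n : ℤ) - 2 - 2 * m + 2 * j + 1 = K j by simp only [K]; ring] at h
    have e : P.eval r = ∑ j ∈ Finset.range (2 * m + 2), a j * (-Real.pi * (T ℝ (K j)).eval r) := by
      simp only [P, Polynomial.eval_finsetSum]
      apply Finset.sum_congr rfl
      intro j _
      simp only [Polynomial.eval_mul, Polynomial.eval_C]
      ring
    rw [e]
    refine tendsto_nhds_unique (hF r hr) (h1.congr' ?_)
    have hs : Set.Ioo (0 : ℝ) (min (r + 1) (1 - r)) ∈ 𝓝[>] (0 : ℝ) :=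
      Ioo_mem_nhdsGT (lt_min (by linarith [hr.1]) (by linarith [hr.2]))
    filter_upwards [hs] with ε hε
    have h1 := lt_min_iff.mp hε.2
    have h0 := hε.1
    unfold PVf
    congr 1
    · apply intervalIntegral.integral_congr
      intro s hs
      rw [Set.uIcc_of_le (by linarith)] at hs
      have := integrand_id m n (s := s) ⟨hs.1, by linarith [hs.2, hr.2]⟩
      simp only
      rw [this]
    · apply intervalIntegral.integral_congr
      intro s hs
      rw [Set.uIcc_of_le (by linarith)] at hs
      have := integrand_id m n (s := s) ⟨by linarith [hs.1, hr.1], hs.2⟩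
      simp only
      rw [this]
  refine ⟨fun r => P.derivative.eval r, ?_, ?_⟩
  · intro r hr
    refine (P.hasDerivAt r).congr_of_eventuallyEq ?_
    filter_upwards [Ioo_mem_nhds hr.1 hr.2] with x hx using hFP x hx
  · intro r hr
    refine (P.derivative.hasDerivAt r).congr_deriv ?_
    have hr0 : 1 - r ^ 2 ≠ 0 := by nlinarith [hr.1, hr.2]
    simp only [P, Polynomial.derivative_sum, Polynomial.derivative_C_mul,
      Polynomial.eval_finsetSum, Polynomial.eval_mul, Polynomial.eval_C, T_second _ hr0]
    rw [show 2 * (m + 1) = 2 * m + 2 by ring, Finset.mul_sum, Finset.mul_sum]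
    apply Finset.sum_congr rfl
    intro j _
    rw [show 2 * m + 2 - 1 = 2 * m + 1 by omega]
    rw [show (n : ℤ) - 1 - 2 * ((m + 1 : ℕ) : ℤ) + 2 * j = K j - 2 by simp only [K]; push_cast; ring,
      show (n : ℤ) + 1 - 2 * ((m + 1 : ℕ) : ℤ) + 2 * j = K j by simp only [K]; push_cast; ring]
    have hK : (K j : ℝ) = (n : ℝ) - 1 - 2 * m + 2 * j := by simp only [K]; push_cast; ring
    rw [hK, ha]
    push_cast
    field_simp
    ring
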